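/- arXiv:2409.02773 — 6 statements merged into one kernel-verified Lean document; each statement's English description precedes it below -/
import Mathlib

section
/- Let A be a unital C*-algebra, let g > 0, and let x, y be self-adjoint elements of A such that x² ≥ g²·1 and y² ≥ g²·1. If ‖x − y‖ < ε, then for every t ∈ [0,1] the self-adjoint element t·x + (1−t)·y satisfies (t·x + (1−t)·y)² ≥ (g² − ε²/4)·1. In particular, if ε < 2g, then the straight-line path t ↦ t·x + (1−t)·y is a continuous path of non-degenerate self-adjoint elements with gap √(g² − ε²/4) connecting x and y. -/
/-- The square of a convex combination is the convex combination of the squares, minus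
`t (1 - t)` times the square of the difference. -/
lemma sq_smul_add_one_sub_smul {A : Type*} [Ring A] [Algebra ℝ A] (t : ℝ) (x y : A) :
    (t • x + (1 - t) • y) ^ 2 = t • x ^ 2 + (1 - t) • y ^ 2 - (t * (1 - t)) • (x - y) ^ 2 := by
  simp only [sq, mul_add, add_mul, mul_sub, sub_mul, smul_mul_assoc, mul_smul_comm]
  module

/-- The square of a self-adjoint element of norm at most `r` is at most `r ^ 2`. -/
lemma IsSelfAdjoint.sq_le_smul_one {A : Type*} [CStarAlgebra A] [PartialOrder A]
    [StarOrderedRing A] {a : A} (ha : IsSelfAdjoint a) {r : ℝ} (har : ‖a‖ ≤ r) :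
    a ^ 2 ≤ (r ^ 2 : ℝ) • (1 : A) := by
  have h : a ^ 2 ≤ (‖a‖ ^ 2 : ℝ) • (1 : A) := by
    simpa [ha.star_eq, sq, Algebra.algebraMap_eq_smul_one] using
      CStarAlgebra.star_mul_le_algebraMap_norm_sq (a := a)
  exact h.trans (smul_le_smul_of_nonneg_right (by gcongr) zero_le_one)


/-- Proposition 3.12 of the paper, for C*-algebras.
If `x, y` are self-adjoint elements of a unital C*-algebra with `x² ≥ g²·1` and
`y² ≥ g²·1` and `‖x - y‖ < ε`, then for every `t ∈ [0,1]` the self-adjoint element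
`t•x + (1-t)•y` satisfies `(t•x + (1-t)•y)² ≥ (g² - ε²/4)·1`.  In particular, if
`ε < 2g`, the straight-line path is a continuous path of non-degenerate self-adjoint
elements with gap `√(g² - ε²/4)` connecting `x` and `y`. -/
theorem stmt0 {A : Type*} [CStarAlgebra A] [PartialOrder A] [StarOrderedRing A]
    (g ε : ℝ) (hg : 0 < g) (x y : A)
    (hx : IsSelfAdjoint x) (hy : IsSelfAdjoint y)
    (hxg : (g ^ 2 : ℝ) • (1 : A) ≤ x ^ 2)
    (hyg : (g ^ 2 : ℝ) • (1 : A) ≤ y ^ 2)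
    (hxy : ‖x - y‖ < ε) :
    (∀ t ∈ Set.Icc (0 : ℝ) 1,
        IsSelfAdjoint (t • x + (1 - t) • y) ∧
        (g ^ 2 - ε ^ 2 / 4 : ℝ) • (1 : A) ≤ (t • x + (1 - t) • y) ^ 2) ∧
    (ε < 2 * g →
      Continuous (fun t : ℝ => t • x + (1 - t) • y) ∧
      (fun t : ℝ => t • x + (1 - t) • y) 1 = x ∧
      (fun t : ℝ => t • x + (1 - t) • y) 0 = y) := by
  refine ⟨fun t ht ↦ ⟨((IsSelfAdjoint.all t).smul hx).add ((IsSelfAdjoint.all (1 - t)).smul hy),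
    ?_⟩, fun _ ↦ ⟨by fun_prop, by simp, by simp⟩⟩
  obtain ⟨ht₀, ht₁⟩ := ht
  have ht₂ : 0 ≤ 1 - t := sub_nonneg.2 ht₁
  have hd : (x - y) ^ 2 ≤ (ε ^ 2 : ℝ) • (1 : A) := (hx.sub hy).sq_le_smul_one hxy.le
  calc (g ^ 2 - ε ^ 2 / 4 : ℝ) • (1 : A)
      ≤ (g ^ 2 - t * (1 - t) * ε ^ 2 : ℝ) • (1 : A) := by
        refine smul_le_smul_of_nonneg_right ?_ zero_le_one
        nlinarith [mul_nonneg (sq_nonneg (2 * t - 1)) (sq_nonneg ε)]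
    _ = t • (g ^ 2 : ℝ) • (1 : A) + (1 - t) • (g ^ 2 : ℝ) • (1 : A)
          - (t * (1 - t)) • (ε ^ 2 : ℝ) • (1 : A) := by module
    _ ≤ t • x ^ 2 + (1 - t) • y ^ 2 - (t * (1 - t)) • (x - y) ^ 2 := by
        gcongr
    _ = (t • x + (1 - t) • y) ^ 2 := (sq_smul_add_one_sub_smul t x y).symm
end

section
/- Let A be a unital C*-algebra, let g > 0, and let x be a self-adjoint element of A with x² ≥ g²·1. If y is a self-adjoint element of A with ‖x − y‖ ≤ ε for some ε < g²/(2‖x‖), then y² ≥ (g² − 2ε‖x‖)·1; in particular y is non-degenerate with gap √(g² − 2ε‖x‖). -/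
/-- Lemma 3.6 of the paper, rigidity of hermitian forms, for
C*-algebras. If `x` is self-adjoint with `x² ≥ g²·1` and `y` is self-adjoint with
`‖x - y‖ ≤ ε` for some `ε < g²/(2‖x‖)`, then `y² ≥ (g² - 2ε‖x‖)·1`; in particular `y`
is non-degenerate with gap `√(g² - 2ε‖x‖)`. -/
theorem stmt1 {A : Type*} [CStarAlgebra A] [PartialOrder A] [StarOrderedRing A]
    (g ε : ℝ) (hg : 0 < g) (x y : A)
    (hx : IsSelfAdjoint x) (hy : IsSelfAdjoint y)
    (hxg : (g ^ 2 : ℝ) • (1 : A) ≤ x ^ 2)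
    (hε : ε < g ^ 2 / (2 * ‖x‖))
    (hxy : ‖x - y‖ ≤ ε) :
    (g ^ 2 - 2 * ε * ‖x‖ : ℝ) • (1 : A) ≤ y ^ 2 := by
  have hd : IsSelfAdjoint (x - y) := hx.sub hy
  have hsa : IsSelfAdjoint (x * (x - y) + (x - y) * x) := by
    simp only [isSelfAdjoint_iff, star_add, star_mul, hx.star_eq, hd.star_eq, add_comm]
  have hnorm : ‖x * (x - y) + (x - y) * x‖ ≤ 2 * ε * ‖x‖ :=
    calc ‖x * (x - y) + (x - y) * x‖
        ≤ ‖x‖ * ‖x - y‖ + ‖x - y‖ * ‖x‖ :=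
          norm_add_le_of_le (norm_mul_le _ _) (norm_mul_le _ _)
      _ = 2 * ‖x - y‖ * ‖x‖ := by ring
      _ ≤ 2 * ε * ‖x‖ := by gcongr
  have hcross : x * (x - y) + (x - y) * x ≤ (2 * ε * ‖x‖ : ℝ) • (1 : A) := by
    rw [← Algebra.algebraMap_eq_smul_one]
    exact hsa.le_algebraMap_norm_self.trans (algebraMap_mono A hnorm)
  calc (g ^ 2 - 2 * ε * ‖x‖ : ℝ) • (1 : A)
      = (g ^ 2 : ℝ) • (1 : A) - (2 * ε * ‖x‖ : ℝ) • (1 : A) := sub_smul _ _ _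
    _ ≤ x ^ 2 - (x * (x - y) + (x - y) * x) := sub_le_sub hxg hcross
    _ ≤ x ^ 2 - (x * (x - y) + (x - y) * x) + (x - y) ^ 2 :=
      le_add_of_nonneg_right hd.sq_nonneg
    _ = y ^ 2 := by noncomm_ring
end

section
/- Let A be a unital C*-algebra, let g > 0, and let x be a self-adjoint element of A with x² ≥ g²·1. Suppose y is a self-adjoint element of A with ‖x − y‖ < ε for some ε > 0 satisfying g² > 2ε‖x‖ + ε²/4. Then for every t ∈ [0,1] one has (t·x + (1−t)·y)² ≥ (g² − 2ε‖x‖ − ε²/4)·1; that is, the straight-line path from x to y consists of non-degenerate self-adjoint elements with gap √(g² − 2ε‖x‖ − ε²/4). -/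
/-- Corollary 3.13 of the paper, for C*-algebras.
If `x` is self-adjoint with `x² ≥ g²·1`, `y` is self-adjoint with `‖x - y‖ < ε` for
some `ε > 0` with `g² > 2ε‖x‖ + ε²/4`, then for every `t ∈ [0,1]` one has
`(t•x + (1-t)•y)² ≥ (g² - 2ε‖x‖ - ε²/4)·1`: the straight-line path from `x` to `y`
consists of non-degenerate self-adjoint elements with gap `√(g² - 2ε‖x‖ - ε²/4)`. -/
theorem stmt2 {A : Type*} [CStarAlgebra A] [PartialOrder A] [StarOrderedRing A]
    (g ε : ℝ) (hg : 0 < g) (hε : 0 < ε) (x y : A)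
    (hx : IsSelfAdjoint x) (hy : IsSelfAdjoint y)
    (hxg : (g ^ 2 : ℝ) • (1 : A) ≤ x ^ 2)
    (hxy : ‖x - y‖ < ε)
    (hbig : g ^ 2 > 2 * ε * ‖x‖ + ε ^ 2 / 4) :
    ∀ t ∈ Set.Icc (0 : ℝ) 1,
      IsSelfAdjoint (t • x + (1 - t) • y) ∧
      (g ^ 2 - 2 * ε * ‖x‖ - ε ^ 2 / 4 : ℝ) • (1 : A) ≤ (t • x + (1 - t) • y) ^ 2 := by
  rintro t ⟨ht0, ht1⟩
  have hd : IsSelfAdjoint (y - x) := hy.sub hx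
  refine ⟨(IsSelfAdjoint.smul (.all t) hx).add (IsSelfAdjoint.smul (.all (1 - t)) hy), ?_⟩
  set d := y - x with hd_def
  set s := 1 - t with hs_def
  have hs0 : 0 ≤ s := by linarith
  have hs1 : s ≤ 1 := by linarith
  have hdε : ‖d‖ ≤ ε := by rw [hd_def, norm_sub_rev]; exact hxy.le
  have hz : t • x + s • y = x + s • d := by
    rw [hd_def, smul_sub, show t = 1 - s by linarith, sub_smul, one_smul]
    abel
  set c := s • (x * d + d * x) with hc_def
  have hsq : (x + s • d) ^ 2 = x ^ 2 + c + (s • d) ^ 2 := by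
    simp only [hc_def, sq, add_mul, mul_add, smul_add, smul_mul_assoc, mul_smul_comm]
    abel
  have hc : IsSelfAdjoint c := by
    refine IsSelfAdjoint.smul (.all s) ?_
    rw [isSelfAdjoint_iff, star_add, star_mul, star_mul, hx.star_eq, hd.star_eq, add_comm]
  have hcn : ‖c‖ ≤ 2 * ε * ‖x‖ := by
    calc ‖c‖ = s * ‖x * d + d * x‖ := by rw [hc_def, norm_smul, Real.norm_of_nonneg hs0]
      _ ≤ 1 * ‖x * d + d * x‖ := by gcongr
      _ ≤ 1 * (‖x‖ * ‖d‖ + ‖d‖ * ‖x‖) := by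
        gcongr
        exact norm_add_le_of_le (norm_mul_le _ _) (norm_mul_le _ _)
      _ ≤ 1 * (‖x‖ * ε + ε * ‖x‖) := by gcongr
      _ = 2 * ε * ‖x‖ := by ring
  have hlow : (-‖c‖) • (1 : A) ≤ c := by
    simpa [Algebra.algebraMap_eq_smul_one] using hc.neg_algebraMap_norm_le_self
  have hnonneg : 0 ≤ (s • d) ^ 2 := (IsSelfAdjoint.smul (.all s) hd).sq_nonneg
  rw [hz, hsq]
  calc (g ^ 2 - 2 * ε * ‖x‖ - ε ^ 2 / 4 : ℝ) • (1 : A) ≤ (g ^ 2 + -‖c‖) • (1 : A) := by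
        refine smul_le_smul_of_nonneg_right ?_ zero_le_one
        nlinarith [sq_nonneg ε]
    _ = (g ^ 2) • (1 : A) + (-‖c‖) • (1 : A) := add_smul _ _ _
    _ ≤ x ^ 2 + c := add_le_add hxg hlow
    _ ≤ x ^ 2 + c + (s • d) ^ 2 := le_add_of_nonneg_right hnonneg
end

section
/- Let A be a unital C*-algebra, let γ, x, D be self-adjoint elements of A with γ² = 1, γx = xγ, and γD = −Dγ, and suppose x² ≥ g²·1 for some g > 0. Then for every κ > 0, (γx + κD)² ≥ κ²·D² + (g² − κ·‖Dx − xD‖)·1; in particular (γx + κD)² ≥ (g² − κ·‖Dx − xD‖)·1, so if κ·‖Dx − xD‖ < g² then the self-adjoint element γx + κD is invertible. -/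
/-- The square of the even spectral localizer. -/
lemma grading_mul_add_smul_sq {R : Type*} [Ring R] [Algebra ℝ R] {γ x D : R}
    (hγ2 : γ ^ 2 = 1) (hγx : γ * x = x * γ) (hγD : γ * D = -(D * γ)) (κ : ℝ) :
    (γ * x + κ • D) ^ 2 = x ^ 2 - κ • (γ * (D * x - x * D)) + (κ ^ 2) • D ^ 2 := by
  have hsq : γ * x * (γ * x) = x ^ 2 := by
    rw [← sq, Commute.mul_pow hγx, hγ2, one_mul]
  have hcross : D * (γ * x) = -(γ * (D * x)) := by
    rw [← mul_assoc, ← mul_assoc, hγD, neg_mul, neg_neg]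
  rw [sq (γ * x + κ • D), add_mul, mul_add, mul_add, hsq, smul_mul_assoc, hcross,
    smul_mul_smul_comm, mul_smul_comm, mul_sub, mul_assoc γ x D, ← sq, ← sq]
  module

/-- The product of a grading with the commutator of an odd and an even self-adjoint element
is self-adjoint. -/
lemma isSelfAdjoint_grading_mul_commutator {R : Type*} [Ring R] [StarRing R] {γ x D : R}
    (hγ : IsSelfAdjoint γ) (hx : IsSelfAdjoint x) (hD : IsSelfAdjoint D)
    (hγx : γ * x = x * γ) (hγD : γ * D = -(D * γ)) :
    IsSelfAdjoint (γ * (D * x - x * D)) := by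
  have h₁ : γ * (D * x) = -(D * x * γ) := by
    rw [← mul_assoc, hγD, neg_mul, mul_assoc, hγx, mul_assoc]
  have h₂ : γ * (x * D) = -(x * D * γ) := by
    rw [← mul_assoc, hγx, mul_assoc, hγD, mul_neg, mul_assoc]
  rw [IsSelfAdjoint, star_mul, star_sub, star_mul, star_mul, hγ.star_eq, hx.star_eq, hD.star_eq,
    mul_sub, sub_mul, h₁, h₂]
  abel

/-- the key estimate, Equation (5) in the proof of Proposition 5.2
of the paper. In a unital C*-algebra, for a grading `γ` (self-adjoint, `γ² = 1`),
an even self-adjoint element `x` (commuting with `γ`) with `x² ≥ g²·1`, and an odd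
self-adjoint element `D` (anticommuting with `γ`), the spectral localizer
`γx + κD` satisfies `(γx + κD)² ≥ κ²D² + (g² − κ‖[D,x]‖)·1` for every `κ > 0`; in
particular `(γx + κD)² ≥ (g² − κ‖[D,x]‖)·1`, so `γx + κD` is invertible whenever
`κ‖[D,x]‖ < g²`. -/
theorem stmt8 {A : Type*} [CStarAlgebra A] [PartialOrder A] [StarOrderedRing A]
    (g : ℝ) (hg : 0 < g) (γ x D : A)
    (hγ : IsSelfAdjoint γ) (hx : IsSelfAdjoint x) (hD : IsSelfAdjoint D)
    (hγ2 : γ ^ 2 = 1) (hγx : γ * x = x * γ) (hγD : γ * D = -(D * γ))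
    (hgap : (g ^ 2 : ℝ) • (1 : A) ≤ x ^ 2) :
    ∀ κ : ℝ, 0 < κ →
      (κ ^ 2 : ℝ) • D ^ 2 + (g ^ 2 - κ * ‖D * x - x * D‖ : ℝ) • (1 : A)
          ≤ (γ * x + κ • D) ^ 2 ∧
      (g ^ 2 - κ * ‖D * x - x * D‖ : ℝ) • (1 : A) ≤ (γ * x + κ • D) ^ 2 ∧
      (κ * ‖D * x - x * D‖ < g ^ 2 → IsUnit (γ * x + κ • D)) := by
  intro κ hκ
  have hsa := isSelfAdjoint_grading_mul_commutator hγ hx hD hγx hγD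
  have hunitary : γ ∈ unitary A := by
    rw [Unitary.mem_iff, hγ.star_eq, ← sq]
    exact ⟨hγ2, hγ2⟩
  have hcomm : γ * (D * x - x * D) ≤ ‖D * x - x * D‖ • (1 : A) := by
    have h := hsa.le_algebraMap_norm_self
    rwa [CStarRing.norm_mem_unitary_mul _ hunitary, Algebra.algebraMap_eq_smul_one] at h
  have hmain : (κ ^ 2 : ℝ) • D ^ 2 + (g ^ 2 - κ * ‖D * x - x * D‖ : ℝ) • (1 : A)
      ≤ (γ * x + κ • D) ^ 2 := by
    rw [grading_mul_add_smul_sq hγ2 hγx hγD, add_comm, sub_smul, mul_smul]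
    gcongr
  have hD2 : 0 ≤ (κ ^ 2 : ℝ) • D ^ 2 := smul_nonneg (sq_nonneg κ) hD.sq_nonneg
  have hbound := (le_add_of_nonneg_left hD2).trans hmain
  refine ⟨hmain, hbound, fun hlt => ?_⟩
  have hpos : 0 < g ^ 2 - κ * ‖D * x - x * D‖ := sub_pos.mpr hlt
  have hunit : IsStrictlyPositive ((g ^ 2 - κ * ‖D * x - x * D‖ : ℝ) • (1 : A)) :=
    isStrictlyPositive_one.smul hpos
  exact (isUnit_pow_iff two_ne_zero).mp (CStarAlgebra.isUnit_of_le _ hbound hunit)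
end

section
/- Let A be a unital C*-algebra, let P ∈ A be a projection (P* = P, P² = P), and let H ∈ A be self-adjoint with H² ≥ g²·1 for some g > 0. Set δ = ‖PH − HP‖ and x = PHP. Then x² = PH²P + P·[P,H]·[P,H]·P, where [P,H] = PH − HP, and consequently x² ≥ (g² − δ²)·P. In particular, if δ < g, then the compression x = PHP is a non-degenerate element of the corarner PAP with gap √(g² − δ²). -/
/-- Example (iv) in Section 3 of the paper: the even spectral
localizer computation. Let `P` be a projection and `H` self-adjoint with `H² ≥ g²·1`.
Set `δ = ‖PH − HP‖` and `x = PHP`. Then `x² = PH²P + P[P,H][P,H]P` (where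
`[P,H] = PH − HP`), and consequently `x² ≥ (g² − δ²)·P`.  In particular, if `δ < g`,
the compression `x = PHP` is a non-degenerate element of the corner `PAP` with gap
`√(g² − δ²)`. -/
theorem stmt9 {A : Type*} [CStarAlgebra A] [PartialOrder A] [StarOrderedRing A]
    (g : ℝ) (hg : 0 < g) (P H : A)
    (hP : star P = P) (hP2 : P ^ 2 = P)
    (hH : IsSelfAdjoint H)
    (hgap : (g ^ 2 : ℝ) • (1 : A) ≤ H ^ 2) :
    (P * H * P) ^ 2
        = P * H ^ 2 * P + P * ((P * H - H * P) * (P * H - H * P)) * P ∧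
    (g ^ 2 - ‖P * H - H * P‖ ^ 2 : ℝ) • P ≤ (P * H * P) ^ 2 := by
  have hPP : P * P = P := by rw [← sq, hP2]
  have hPPx (x : A) : P * (P * x) = P * x := by rw [← mul_assoc, hPP]
  have hid : (P * H * P) ^ 2
      = P * H ^ 2 * P + P * ((P * H - H * P) * (P * H - H * P)) * P := by
    simp only [sq, mul_sub, sub_mul, mul_assoc, hPP, hPPx]
    abel
  refine ⟨hid, ?_⟩
  set K := P * H - H * P with hK
  have hKs : star K = -K := by
    simp [hK, hP, hH.star_eq]
  have hKK : -(‖K‖ ^ 2 • (1 : A)) ≤ K * K := by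
    have h := CStarAlgebra.star_mul_le_algebraMap_norm_sq (a := K)
    rw [hKs, neg_mul, Algebra.algebraMap_eq_smul_one] at h
    exact neg_le.mp h
  have hsum : (g ^ 2 - ‖K‖ ^ 2) • (1 : A) ≤ H ^ 2 + K * K := by
    rw [sub_smul, sub_eq_add_neg]
    exact add_le_add hgap hKK
  have hconj := star_left_conjugate_le_conjugate hsum P
  rw [hP] at hconj
  rw [hid]
  simpa only [mul_add, add_mul, mul_smul_comm, smul_mul_assoc, mul_one, hPP] using hconj
end

section
/- Let A be a unital C*-algebra and let x, y ∈ A be invertible self-adjoint elements. Set p = ½(1 − x·|x|⁻¹) and q = ½(1 − y·|y|⁻¹), where |x| is the positive square root of x². Then p and q are projections, and there exists a continuous path of invertible self-adjoint elements of A from x to y if and only if there exists a continuous path of projections in A from p to q. -/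
/-- The continuous functional calculus of a function continuous away from `0` is continuous on the
invertible self-adjoint elements. -/
theorem continuousOn_cfc_isSelfAdjoint_isUnit {A : Type*} [CStarAlgebra A] {f : ℝ → ℝ}
    (hf : ContinuousOn f {0}ᶜ) :
    ContinuousOn (fun z : A => cfc f z) {z : A | IsSelfAdjoint z ∧ IsUnit z} := by
  refine continuousOn_id.cfc_of_mem_nhdsSet (s := {0}ᶜ) f ?_ (fun z hz => hz.1) hf
  refine isOpen_compl_singleton.mem_nhdsSet.2 (Set.iUnion₂_subset fun z hz => ?_)
  rintro r hr rfl
  exact spectrum.zero_notMem ℝ hz.2 hr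

theorem continuousOn_abs_inv : ContinuousOn (fun r : ℝ => |r|⁻¹) {0}ᶜ :=
  continuous_abs.continuousOn.inv₀ fun _ hr => abs_ne_zero.2 hr

theorem ne_zero_of_mem_spectrum {A : Type*} [CStarAlgebra A] {x : A} (hxu : IsUnit x) {r : ℝ}
    (hr : r ∈ spectrum ℝ x) : r ≠ 0 :=
  ne_of_mem_of_not_mem hr (spectrum.zero_notMem ℝ hxu)

theorem continuousOn_abs_inv_spectrum {A : Type*} [CStarAlgebra A] {x : A} (hxu : IsUnit x) :
    ContinuousOn (fun r : ℝ => |r|⁻¹) (spectrum ℝ x) :=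
  continuousOn_abs_inv.mono fun _ hr => ne_zero_of_mem_spectrum hxu hr

theorem mul_cfc_abs_inv_eq_cfc {A : Type*} [CStarAlgebra A] {x : A} (hx : IsSelfAdjoint x)
    (hxu : IsUnit x) :
    x * cfc (fun r : ℝ => |r|⁻¹) x = cfc (fun r : ℝ => r * |r|⁻¹) x := by
  rw [cfc_mul (fun r : ℝ => r) _ x continuousOn_id (continuousOn_abs_inv_spectrum hxu),
    cfc_id' ℝ x]

theorem isSelfAdjoint_mul_cfc_abs_inv {A : Type*} [CStarAlgebra A] {x : A}
    (hx : IsSelfAdjoint x) (hxu : IsUnit x) :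
    IsSelfAdjoint (x * cfc (fun r : ℝ => |r|⁻¹) x) := by
  rw [mul_cfc_abs_inv_eq_cfc hx hxu]
  exact cfc_predicate _ _

theorem mul_cfc_abs_inv_mul_self {A : Type*} [CStarAlgebra A] {x : A}
    (hx : IsSelfAdjoint x) (hxu : IsUnit x) :
    x * cfc (fun r : ℝ => |r|⁻¹) x * (x * cfc (fun r : ℝ => |r|⁻¹) x) = 1 := by
  have hc : ContinuousOn (fun r : ℝ => r * |r|⁻¹) (spectrum ℝ x) :=
    continuousOn_id.mul (continuousOn_abs_inv_spectrum hxu)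
  rw [mul_cfc_abs_inv_eq_cfc hx hxu, ← cfc_mul _ _ x hc hc, ← cfc_one ℝ x]
  refine cfc_congr fun r hr => ?_
  have hr0 := abs_ne_zero.2 (ne_zero_of_mem_spectrum hxu hr)
  simp only [Pi.one_apply]
  field_simp
  simp

theorem star_half_smul_one_sub {A : Type*} [CStarAlgebra A] {u : A} (hu : IsSelfAdjoint u) :
    star ((1 / 2 : ℝ) • (1 - u)) = (1 / 2 : ℝ) • (1 - u) := by
  simp [hu.star_eq]

theorem half_smul_one_sub_sq {A : Type*} [CStarAlgebra A] {u : A} (hu : u * u = 1) :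
    ((1 / 2 : ℝ) • (1 - u)) ^ 2 = (1 / 2 : ℝ) • (1 - u) := by
  rw [sq, smul_mul_smul_comm, sub_mul, mul_sub, mul_sub, hu]
  simp only [mul_one, one_mul]
  module

theorem isUnit_one_sub_two_smul {A : Type*} [CStarAlgebra A] {p : A} (hp : p ^ 2 = p) :
    IsUnit (1 - (2 : ℝ) • p) := by
  refine IsUnit.of_pow_eq_one (n := 2) ?_ two_ne_zero
  rw [sq, sub_mul, mul_sub, mul_sub, smul_mul_smul_comm, ← sq p, hp]
  simp only [mul_one, one_mul]
  module

/-- An invertible self-adjoint element is joined to its unitary part `x|x|⁻¹` by a line segment of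
invertible self-adjoint elements. -/
theorem joinedIn_mul_cfc_abs_inv {A : Type*} [CStarAlgebra A] {x : A}
    (hx : IsSelfAdjoint x) (hxu : IsUnit x) :
    JoinedIn {z : A | IsSelfAdjoint z ∧ IsUnit z} x (x * cfc (fun r : ℝ => |r|⁻¹) x) := by
  refine JoinedIn.of_segment_subset ?_
  rintro _ ⟨a, b, ha, hb, hab, rfl⟩
  have hc : ContinuousOn (fun r : ℝ => a + b * |r|⁻¹) (spectrum ℝ x) :=
    continuousOn_const.add (continuousOn_const.mul (continuousOn_abs_inv_spectrum hxu))
  have hsa : IsSelfAdjoint (a • x + b • (x * cfc (fun r : ℝ => |r|⁻¹) x)) :=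
    ((IsSelfAdjoint.all a).smul hx).add
      ((IsSelfAdjoint.all b).smul (isSelfAdjoint_mul_cfc_abs_inv hx hxu))
  have heq : a • x + b • (x * cfc (fun r : ℝ => |r|⁻¹) x) =
      x * cfc (fun r : ℝ => a + b * |r|⁻¹) x := by
    rw [cfc_const_add a (fun r : ℝ => b * |r|⁻¹) x
        (continuousOn_const.mul (continuousOn_abs_inv_spectrum hxu)),
      cfc_const_mul b _ x (continuousOn_abs_inv_spectrum hxu), mul_add, mul_smul_comm,
      Algebra.algebraMap_eq_smul_one, mul_smul_comm, mul_one]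
  refine ⟨hsa, heq ▸ hxu.mul ((isUnit_cfc_iff _ x hc).2 fun r hr => ?_)⟩
  have hr0 : 0 < |r|⁻¹ := inv_pos.2 (abs_pos.2 (ne_zero_of_mem_spectrum hxu hr))
  rcases ha.eq_or_lt with rfl | ha
  · have : b = 1 := by linarith
    subst this
    positivity
  · positivity

theorem exists_continuous_real_iff_joinedIn {X : Type*} [TopologicalSpace X] {S : Set X}
    {x y : X} :
    (∃ z : ℝ → X, Continuous z ∧ (∀ t ∈ Set.Icc (0 : ℝ) 1, z t ∈ S) ∧ z 0 = x ∧ z 1 = y) ↔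
      JoinedIn S x y := by
  constructor
  · rintro ⟨z, hz, hS, h0, h1⟩
    exact JoinedIn.ofLine hz.continuousOn h0 h1 (Set.image_subset_iff.2 hS)
  · rintro ⟨γ, hγ⟩
    refine ⟨γ.extend, γ.continuous_extend, fun t ht => ?_, γ.extend_zero, γ.extend_one⟩
    rw [γ.extend_apply ht]
    exact hγ _

/-- the Proposition of Section 3.2 of the paper at fixed matrix
size: `K₀(A)` agrees with C*-algebraic K-theory. Let `x, y` be invertible
self-adjoint elements of a unital C*-algebra and set `p = ½(1 − x|x|⁻¹)`,
`q = ½(1 − y|y|⁻¹)`, where `|x| = cfc (|·|) x` is the positive square root of `x²`.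
Then `p` and `q` are projections, and there is a continuous path of invertible
self-adjoint elements from `x` to `y` if and only if there is a continuous path of
projections from `p` to `q`. -/
theorem stmt13 {A : Type*} [CStarAlgebra A] [PartialOrder A] [StarOrderedRing A]
    (x y : A) (hx : IsSelfAdjoint x) (hy : IsSelfAdjoint y)
    (hxu : IsUnit x) (hyu : IsUnit y)
    (p q : A)
    (hp : p = (1 / 2 : ℝ) • (1 - x * cfc (fun r : ℝ => |r|⁻¹) x))
    (hq : q = (1 / 2 : ℝ) • (1 - y * cfc (fun r : ℝ => |r|⁻¹) y)) :
    (star p = p ∧ p ^ 2 = p) ∧ (star q = q ∧ q ^ 2 = q) ∧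
    ((∃ z : ℝ → A, Continuous z ∧
        (∀ t ∈ Set.Icc (0 : ℝ) 1, IsSelfAdjoint (z t) ∧ IsUnit (z t)) ∧
        z 0 = x ∧ z 1 = y) ↔
      (∃ w : ℝ → A, Continuous w ∧
        (∀ t ∈ Set.Icc (0 : ℝ) 1, star (w t) = w t ∧ (w t) ^ 2 = w t) ∧
        w 0 = p ∧ w 1 = q)) := by
  have one_sub_two (u : A) : 1 - (2 : ℝ) • ((1 / 2 : ℝ) • (1 - u)) = u := by module
  have hproj {z : A} (hz : IsSelfAdjoint z) (hzu : IsUnit z) :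
      (1 / 2 : ℝ) • (1 - z * cfc (fun r : ℝ => |r|⁻¹) z) ∈ {w : A | star w = w ∧ w ^ 2 = w} :=
    ⟨star_half_smul_one_sub (isSelfAdjoint_mul_cfc_abs_inv hz hzu),
      half_smul_one_sub_sq (mul_cfc_abs_inv_mul_self hz hzu)⟩
  subst hp hq
  refine ⟨hproj hx hxu, hproj hy hyu, ?_⟩
  refine (exists_continuous_real_iff_joinedIn (S := {z : A | IsSelfAdjoint z ∧ IsUnit z})).trans
    (Iff.trans ⟨fun h => ?_, fun h => ?_⟩
      (exists_continuous_real_iff_joinedIn (S := {w : A | star w = w ∧ w ^ 2 = w})).symm)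
  · have hc : ContinuousOn (fun z : A => (1 / 2 : ℝ) • (1 - z * cfc (fun r : ℝ => |r|⁻¹) z))
        {z : A | IsSelfAdjoint z ∧ IsUnit z} :=
      (continuousOn_const.sub (continuousOn_id.mul
        (continuousOn_cfc_isSelfAdjoint_isUnit continuousOn_abs_inv))).const_smul _
    exact (h.map_continuousOn hc).mono (Set.image_subset_iff.2 fun z hz => hproj hz.1 hz.2)
  · have hc : Continuous (fun w : A => 1 - (2 : ℝ) • w) := by fun_prop
    have hsub : (fun w : A => 1 - (2 : ℝ) • w) '' {w : A | star w = w ∧ w ^ 2 = w} ⊆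
        {z : A | IsSelfAdjoint z ∧ IsUnit z} := by
      rintro _ ⟨w, ⟨hw, hw2⟩, rfl⟩
      exact ⟨(IsSelfAdjoint.one A).sub ((IsSelfAdjoint.all (2 : ℝ)).smul hw),
        isUnit_one_sub_two_smul hw2⟩
    have hmid := (h.map hc).mono hsub
    simp only [one_sub_two] at hmid
    exact ((joinedIn_mul_cfc_abs_inv hx hxu).trans hmid).trans
      (joinedIn_mul_cfc_abs_inv hy hyu).symm
end
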